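/- arXiv:2504.06248 — 2 statements merged into one kernel-verified Lean document; each statement's English description precedes it below -/
import Mathlib

section
/- Let N ≥ 4, let a, b, c, d ∈ {1,…,N} be pairwise distinct, assume all phase lags vanish (α_{jk} = 0 for all j,k) and σ ≠ 0. Then the identity Σ_{j=1}^N F_j(θ) ∂C_{abcd}/∂θ_j(θ) = 0 holds for all θ ∈ ℝ^N at which C_{abcd} is defined if and only if: (1) W_{ba} = W_{ca} = W_{da}, W_{ab} = W_{cb} = W_{db}, W_{ac} = W_{bc} = W_{dc}, W_{ad} = W_{bd} = W_{cd}; (2) W_{ak} = W_{bk} = W_{ck} = W_{dk} for all k ∈ {1,…,N} \ {a,b,c,d}; and (3) ω_a = ω_b = ω_c = ω_d. -/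
/-- The Kuramoto vector field. -/
noncomputable def kuramotoF {N : ℕ} (W α : Fin N → Fin N → ℝ) (ω : Fin N → ℝ) (σ : ℝ)
    (θ : Fin N → ℝ) : Fin N → ℝ :=
  fun j => ω j + σ * ∑ k, W j k * Real.sin (θ k - θ j - α j k)

/-- The phase cross-ratio of four oscillators. -/
noncomputable def crossRatioTheta {N : ℕ} (a b c d : Fin N) (θ : Fin N → ℝ) : ℝ :=
  (Real.sin ((θ c - θ a) / 2) * Real.sin ((θ d - θ b) / 2)) /
    (Real.sin ((θ c - θ b) / 2) * Real.sin ((θ d - θ a) / 2))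

open Real in
/-- Up to the positive factor `2 * (sin ((θ c - θ b) / 2) * sin ((θ d - θ a) / 2)) ^ 2`, the
derivative of the phase cross-ratio at `θ` along `v`. -/
noncomputable def crossRatioForm {N : ℕ} (a b c d : Fin N) (θ v : Fin N → ℝ) : ℝ :=
  v a * (sin ((θ d - θ b) / 2) * sin ((θ c - θ b) / 2) * sin ((θ c - θ d) / 2)) +
  v b * (sin ((θ c - θ a) / 2) * sin ((θ d - θ a) / 2) * sin ((θ d - θ c) / 2)) +
  v c * (sin ((θ d - θ b) / 2) * sin ((θ d - θ a) / 2) * sin ((θ a - θ b) / 2)) +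
  v d * (sin ((θ c - θ a) / 2) * sin ((θ c - θ b) / 2) * sin ((θ b - θ a) / 2))

theorem sum_mul_fderiv_single {ι : Type*} [Fintype ι] [DecidableEq ι] (f : (ι → ℝ) → ℝ)
    (θ v : ι → ℝ) : ∑ j, v j * fderiv ℝ f θ (Pi.single j 1) = fderiv ℝ f θ v := by
  conv_rhs => rw [pi_eq_sum_univ' v, map_sum]
  refine Finset.sum_congr rfl fun j _ => ?_
  rw [map_smul, smul_eq_mul]

theorem fderiv_crossRatioTheta {N : ℕ} (a b c d : Fin N) (θ v : Fin N → ℝ)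
    (h : Real.sin ((θ c - θ b) / 2) * Real.sin ((θ d - θ a) / 2) ≠ 0) :
    fderiv ℝ (crossRatioTheta a b c d) θ v =
      crossRatioForm a b c d θ v /
        (2 * (Real.sin ((θ c - θ b) / 2) * Real.sin ((θ d - θ a) / 2)) ^ 2) := by
  have hdiff : DifferentiableAt ℝ (crossRatioTheta a b c d) θ := by
    unfold crossRatioTheta
    fun_prop (disch := exact h)
  have hsin (i j : Fin N) : HasDerivAt (fun t : ℝ => Real.sin (((θ + t • v) i - (θ + t • v) j) / 2))
      (Real.cos ((θ i - θ j) / 2) * ((v i - v j) / 2)) 0 := by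
    have hlin (i : Fin N) : HasDerivAt (fun t : ℝ => (θ + t • v) i) (v i) 0 := by
      simpa using ((hasDerivAt_id (0 : ℝ)).mul_const (v i)).const_add (θ i)
    simpa using (((hlin i).sub (hlin j)).div_const 2).sin
  rw [← hdiff.lineDeriv_eq_fderiv]
  have hC := ((hsin c a).mul (hsin d b)).div ((hsin c b).mul (hsin d a)) (by simpa using h)
  refine (HasDerivAt.deriv hC).trans ?_
  have hab : Real.sin ((θ a - θ b) / 2) =
      Real.sin ((θ c - θ b) / 2) * Real.cos ((θ c - θ a) / 2) -
        Real.cos ((θ c - θ b) / 2) * Real.sin ((θ c - θ a) / 2) := by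
    rw [← Real.sin_sub]; ring_nf
  have hba : Real.sin ((θ b - θ a) / 2) =
      Real.sin ((θ d - θ a) / 2) * Real.cos ((θ d - θ b) / 2) -
        Real.cos ((θ d - θ a) / 2) * Real.sin ((θ d - θ b) / 2) := by
    rw [← Real.sin_sub]; ring_nf
  have hcd : Real.sin ((θ c - θ d) / 2) =
      Real.sin ((θ c - θ a) / 2) * Real.cos ((θ d - θ a) / 2) -
        Real.cos ((θ c - θ a) / 2) * Real.sin ((θ d - θ a) / 2) := by
    rw [← Real.sin_sub]; ring_nf
  have hdc : Real.sin ((θ d - θ c) / 2) =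
      Real.sin ((θ d - θ b) / 2) * Real.cos ((θ c - θ b) / 2) -
        Real.cos ((θ d - θ b) / 2) * Real.sin ((θ c - θ b) / 2) := by
    rw [← Real.sin_sub]; ring_nf
  have h1 := left_ne_zero_of_mul h
  have h2 := right_ne_zero_of_mul h
  simp only [crossRatioForm, hab, hba, hcd, hdc, zero_smul, add_zero, Pi.mul_apply]
  field_simp
  ring

theorem sum_mul_fderiv_crossRatioTheta_eq_zero_iff {N : ℕ} (a b c d : Fin N) (θ v : Fin N → ℝ)
    (h : Real.sin ((θ c - θ b) / 2) * Real.sin ((θ d - θ a) / 2) ≠ 0) :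
    ∑ j, v j * fderiv ℝ (crossRatioTheta a b c d) θ (Pi.single j 1) = 0 ↔
      crossRatioForm a b c d θ v = 0 := by
  rw [sum_mul_fderiv_single, fderiv_crossRatioTheta a b c d θ v h, div_eq_zero_iff]
  simp only [or_iff_left (mul_ne_zero two_ne_zero (pow_ne_zero 2 h))]

/-- The form vanishes on the infinitesimal Möbius transformations of the circle. -/
theorem crossRatioForm_eq_zero {N : ℕ} {a b c d : Fin N} {θ v : Fin N → ℝ} (p q r : ℝ)
    (hv : ∀ j, j = a ∨ j = b ∨ j = c ∨ j = d →
      v j = p + q * Real.cos (θ j) + r * Real.sin (θ j)) :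
    crossRatioForm a b c d θ v = 0 := by
  have hv' (j : Fin N) (hj : j = a ∨ j = b ∨ j = c ∨ j = d) :
      v j = (p + q) * Real.cos (θ j / 2) ^ 2 + (p - q) * Real.sin (θ j / 2) ^ 2 +
        2 * r * (Real.sin (θ j / 2) * Real.cos (θ j / 2)) := by
    have hj2 : θ j = 2 * (θ j / 2) := by ring
    rw [hv j hj]
    conv_lhs => rw [hj2, Real.cos_two_mul, Real.sin_two_mul]
    linear_combination (q - p) * Real.sin_sq_add_cos_sq (θ j / 2)
  simp only [crossRatioForm, hv' a (by simp), hv' b (by simp), hv' c (by simp), hv' d (by simp),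
    sub_div, Real.sin_sub]
  ring

theorem kuramotoF_zero_lag_apply {N : ℕ} (W : Fin N → Fin N → ℝ) (ω : Fin N → ℝ) (σ : ℝ)
    (θ : Fin N → ℝ) (j : Fin N) :
    kuramotoF W (fun _ _ => 0) ω σ θ j =
      ω j + (σ * ∑ k, W j k * Real.sin (θ k)) * Real.cos (θ j) +
        (-(σ * ∑ k, W j k * Real.cos (θ k))) * Real.sin (θ j) := by
  have : ∑ k, W j k * Real.sin (θ k - θ j - 0) =
      (∑ k, W j k * Real.sin (θ k)) * Real.cos (θ j) -
        (∑ k, W j k * Real.cos (θ k)) * Real.sin (θ j) := by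
    rw [Finset.sum_mul, Finset.sum_mul, ← Finset.sum_sub_distrib]
    refine Finset.sum_congr rfl fun k _ => ?_
    rw [sub_zero, Real.sin_sub]
    ring
  rw [kuramotoF, this]
  ring

/-- The coupling of an oscillator to itself does not enter the vector field at zero phase lag. -/
theorem kuramotoF_zero_lag_eq_of_row {N : ℕ} {W : Fin N → Fin N → ℝ} {ω : Fin N → ℝ} (σ : ℝ)
    (θ : Fin N → ℝ) {j : Fin N} {ω₀ : ℝ} {w : Fin N → ℝ} (hω : ω j = ω₀)
    (hw : ∀ k, k ≠ j → W j k = w k) :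
    kuramotoF W (fun _ _ => 0) ω σ θ j =
      ω₀ + (σ * ∑ k, w k * Real.sin (θ k)) * Real.cos (θ j) +
        (-(σ * ∑ k, w k * Real.cos (θ k))) * Real.sin (θ j) := by
  rw [← kuramotoF_zero_lag_apply (fun _ => w) (fun _ => ω₀), kuramotoF, kuramotoF, hω]
  congr 2
  refine Finset.sum_congr rfl fun k _ => ?_
  rcases eq_or_ne k j with rfl | hk
  · simp
  · rw [hw k hk]

theorem eq_zero_of_forall_add_sum_sin_eq_zero {N : ℕ} {p q r s : Fin N} (hrp : r ≠ p) (hrq : r ≠ q)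
    (hsp : s ≠ p) (hsq : s ≠ q) (hrs : r ≠ s) {e : ℝ} {D : Fin N → ℝ}
    (h : ∀ θ : Fin N → ℝ, θ p = 0 → θ q = 0 → Real.sin (θ r / 2) ≠ 0 → Real.sin (θ s / 2) ≠ 0 →
      Real.sin ((θ r - θ s) / 2) ≠ 0 → e + ∑ k, D k * Real.sin (θ k) = 0) :
    e = 0 ∧ ∀ k, k ≠ p → k ≠ q → k ≠ r → D k = 0 := by
  have hpi := Real.pi_pos
  have hpos : e + D s = 0 := by
    have := h (fun j => if j = r then Real.pi else if j = s then Real.pi / 2 else 0)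
      (by simp [hrp.symm, hsp.symm]) (by simp [hrq.symm, hsq.symm]) (by simp)
      (by simpa [hrs.symm] using
        (Real.sin_pos_of_pos_of_lt_pi (by linarith) (by linarith)).ne')
      (by simpa [hrs.symm] using
        (Real.sin_pos_of_pos_of_lt_pi (by linarith) (by linarith)).ne')
    rw [Fintype.sum_eq_single s] at this
    · simpa [hrs.symm] using this
    · intro k hk
      by_cases hkr : k = r <;> simp [hkr, hk]
  have hneg : e - D s = 0 := by
    have := h (fun j => if j = r then Real.pi else if j = s then -(Real.pi / 2) else 0)
      (by simp [hrp.symm, hsp.symm]) (by simp [hrq.symm, hsq.symm]) (by simp)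
      (by simpa [hrs.symm] using
        (Real.sin_neg_of_neg_of_neg_pi_lt (x := -(Real.pi / 2) / 2)
          (by linarith) (by linarith)).ne)
      (by simpa [hrs.symm] using
        (Real.sin_pos_of_pos_of_lt_pi (x := (Real.pi + Real.pi / 2) / 2)
          (by linarith) (by linarith)).ne')
    rw [Fintype.sum_eq_single s] at this
    · simpa [hrs.symm, sub_eq_add_neg] using this
    · intro k hk
      by_cases hkr : k = r <;> simp [hkr, hk]
  refine ⟨by linarith, fun k hkp hkq hkr => ?_⟩
  rcases eq_or_ne k s with rfl | hks
  · linarith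
  have := h (fun j => if j = r then Real.pi else if j = s ∨ j = k then Real.pi / 2 else 0)
    (by simp [hrp.symm, hsp.symm, hkp.symm]) (by simp [hrq.symm, hsq.symm, hkq.symm]) (by simp)
    (by simpa [hrs.symm] using
      (Real.sin_pos_of_pos_of_lt_pi (by linarith) (by linarith)).ne')
    (by simpa [hrs.symm] using
      (Real.sin_pos_of_pos_of_lt_pi (by linarith) (by linarith)).ne')
  rw [Fintype.sum_eq_add s k hks.symm] at this
  · simp [hrs.symm, hkr] at this
    linarith
  · rintro j ⟨hjs, hjk⟩
    by_cases hjr : j = r <;> simp [hjr, hjs, hjk]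

/-- If two oscillators in phase always have the same velocity, then they have the same natural
frequency and are driven identically by all the other oscillators. -/
theorem eq_of_forall_kuramotoF_eq {N : ℕ} {W : Fin N → Fin N → ℝ} {ω : Fin N → ℝ} {σ : ℝ}
    (hσ : σ ≠ 0) {p q r s : Fin N} (hrp : r ≠ p) (hrq : r ≠ q)
    (hsp : s ≠ p) (hsq : s ≠ q) (hrs : r ≠ s)
    (h : ∀ θ : Fin N → ℝ, θ p = 0 → θ q = 0 → Real.sin (θ r / 2) ≠ 0 → Real.sin (θ s / 2) ≠ 0 →
      Real.sin ((θ r - θ s) / 2) ≠ 0 →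
      kuramotoF W (fun _ _ => 0) ω σ θ p = kuramotoF W (fun _ _ => 0) ω σ θ q) :
    ω p = ω q ∧ ∀ k, k ≠ p → k ≠ q → W p k = W q k := by
  have key (θ : Fin N → ℝ) (hp : θ p = 0) (hq : θ q = 0) (hr : Real.sin (θ r / 2) ≠ 0)
      (hs : Real.sin (θ s / 2) ≠ 0) (hrs' : Real.sin ((θ r - θ s) / 2) ≠ 0) :
      (ω p - ω q) + ∑ k, σ * (W p k - W q k) * Real.sin (θ k) = 0 := by
    have := h θ hp hq hr hs hrs'
    rw [kuramotoF_zero_lag_apply, kuramotoF_zero_lag_apply, hp, hq] at this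
    simp only [Real.cos_zero, Real.sin_zero, mul_one, mul_zero, add_zero] at this
    simp only [mul_assoc, sub_mul, ← Finset.mul_sum, Finset.sum_sub_distrib]
    linarith
  have hweight {k : Fin N} (hk : σ * (W p k - W q k) = 0) : W p k = W q k :=
    sub_eq_zero.mp ((mul_eq_zero.mp hk).resolve_left hσ)
  obtain ⟨he, hD⟩ := eq_zero_of_forall_add_sum_sin_eq_zero hrp hrq hsp hsq hrs key
  have hD' := (eq_zero_of_forall_add_sum_sin_eq_zero hsp hsq hrp hrq hrs.symm
    (fun θ hp hq hs hr hsr => key θ hp hq hr hs (by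
      rw [← neg_sub, neg_div, Real.sin_neg]
      exact neg_ne_zero.mpr hsr))).2
  refine ⟨sub_eq_zero.mp he, fun k hkp hkq => hweight ?_⟩
  rcases eq_or_ne k r with rfl | hkr
  · exact hD' k hkp hkq hrs
  · exact hD k hkp hkq hkr

/-- Cross-ratio conservation in the zero-phase-lag Kuramoto model: `c_{abcd}` is a constant of
motion iff `a,b,c,d` have the same outgoing edges within `{a,b,c,d}`, the same incoming edges
from outside, and identical natural frequencies. -/
theorem crossratio_conservation_zero_phase_lag (N : ℕ) (hN : 4 ≤ N)
    (W : Fin N → Fin N → ℝ) (ω : Fin N → ℝ) (σ : ℝ) (hσ : σ ≠ 0)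
    (hW : ∀ j, W j j = 0)
    (a b c d : Fin N) (hab : a ≠ b) (hac : a ≠ c) (had : a ≠ d)
    (hbc : b ≠ c) (hbd : b ≠ d) (hcd : c ≠ d) :
    (∀ θ : Fin N → ℝ,
        Real.sin ((θ c - θ b) / 2) * Real.sin ((θ d - θ a) / 2) ≠ 0 →
        ∑ j, kuramotoF W (fun _ _ => 0) ω σ θ j *
          fderiv ℝ (crossRatioTheta a b c d) θ (Pi.single j 1) = 0) ↔
      ((W b a = W c a ∧ W c a = W d a) ∧
       (W a b = W c b ∧ W c b = W d b) ∧
       (W a c = W b c ∧ W b c = W d c) ∧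
       (W a d = W b d ∧ W b d = W c d) ∧
       (∀ k, k ≠ a → k ≠ b → k ≠ c → k ≠ d →
          W a k = W b k ∧ W b k = W c k ∧ W c k = W d k) ∧
       (ω a = ω b ∧ ω b = ω c ∧ ω c = ω d)) := by
  have hneg (x y : ℝ) : Real.sin ((x - y) / 2) = -Real.sin ((y - x) / 2) := by
    rw [← Real.sin_neg]; ring_nf
  constructor
  · intro h
    have hform (θ : Fin N → ℝ)
        (hθ : Real.sin ((θ c - θ b) / 2) * Real.sin ((θ d - θ a) / 2) ≠ 0) :
        crossRatioForm a b c d θ (kuramotoF W (fun _ _ => 0) ω σ θ) = 0 :=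
      (sum_mul_fderiv_crossRatioTheta_eq_zero_iff a b c d θ _ hθ).mp (h θ hθ)
    obtain ⟨ωab, Wab⟩ := eq_of_forall_kuramotoF_eq (W := W) (ω := ω) hσ
      hac.symm hbc.symm had.symm hbd.symm hcd (by
        intro θ ha hb hc hd hcd'
        have H := hform θ (by simpa [ha, hb] using ⟨hc, hd⟩)
        rw [crossRatioForm, ha, hb, hneg (θ d) (θ c)] at H
        simp only [sub_zero, sub_self, zero_div, Real.sin_zero, mul_zero, add_zero] at H
        apply mul_right_cancel₀ (mul_ne_zero (mul_ne_zero hc hd) hcd')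
        linear_combination H)
    obtain ⟨-, Wac⟩ := eq_of_forall_kuramotoF_eq (W := W) (ω := ω) hσ
      hab.symm hbc had.symm hcd.symm hbd (by
        intro θ ha hc hb hd hbd'
        have H := hform θ (by simpa [ha, hc, neg_div] using ⟨hb, hd⟩)
        rw [crossRatioForm, ha, hc, hneg 0 (θ b), hneg 0 (θ d), hneg (θ d) (θ b)] at H
        simp only [sub_zero, sub_self, zero_div, Real.sin_zero, mul_zero, zero_mul, add_zero] at H
        apply mul_right_cancel₀ (mul_ne_zero (mul_ne_zero hb hd) hbd')
        linear_combination -H)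
    obtain ⟨ωbd, Wbd⟩ := eq_of_forall_kuramotoF_eq (W := W) (ω := ω) hσ
      hab had hbc.symm hcd hac (by
        intro θ hb hd ha hc hac'
        have H := hform θ (by simpa [hb, hd, neg_div] using ⟨hc, ha⟩)
        rw [crossRatioForm, hb, hd, hneg 0 (θ a), hneg 0 (θ c), hneg (θ c) (θ a)] at H
        simp only [sub_zero, sub_self, zero_div, Real.sin_zero, mul_zero, zero_mul, add_zero] at H
        apply mul_right_cancel₀ (mul_ne_zero (mul_ne_zero ha hc) hac')
        linear_combination -H)
    obtain ⟨ωcd, Wcd⟩ := eq_of_forall_kuramotoF_eq (W := W) (ω := ω) hσ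
      hac had hbc hbd hab (by
        intro θ hc hd ha hb hab'
        have H := hform θ (by simpa [hc, hd, neg_div] using ⟨hb, ha⟩)
        rw [crossRatioForm, hc, hd, hneg 0 (θ a), hneg 0 (θ b), hneg (θ b) (θ a)] at H
        simp only [sub_zero, sub_self, zero_div, Real.sin_zero, mul_zero, add_zero] at H
        apply mul_right_cancel₀ (mul_ne_zero (mul_ne_zero ha hb) hab')
        linear_combination H)
    refine ⟨⟨(Wbd a hab had).trans (Wcd a hac had).symm, Wcd a hac had⟩,
      ⟨Wac b hab.symm hbc, Wcd b hbc hbd⟩,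
      ⟨Wab c hac.symm hbc.symm, Wbd c hbc.symm hcd⟩,
      ⟨Wab d had.symm hbd.symm,
        (Wab d had.symm hbd.symm).symm.trans (Wac d had.symm hcd.symm)⟩,
      fun k hka hkb hkc hkd => ⟨Wab k hka hkb,
        (Wab k hka hkb).symm.trans (Wac k hka hkc), Wcd k hkc hkd⟩,
      ωab, ωbd.trans ωcd.symm, ωcd⟩
  · rintro ⟨⟨ha₁, ha₂⟩, ⟨hb₁, hb₂⟩, ⟨hc₁, hc₂⟩, ⟨hd₁, hd₂⟩, hk, hω₁, hω₂, hω₃⟩ θ hθ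
    rw [sum_mul_fderiv_crossRatioTheta_eq_zero_iff a b c d θ _ hθ]
    let w : Fin N → ℝ := fun k => if k = a then W b a else W a k
    refine crossRatioForm_eq_zero (ω a) (σ * ∑ k, w k * Real.sin (θ k))
      (-(σ * ∑ k, w k * Real.cos (θ k))) fun j hj => ?_
    have hωj : ω j = ω a := by grind
    refine kuramotoF_zero_lag_eq_of_row σ θ hωj fun k hkj => ?_
    simp only [w]
    grind
end

section
/- Let N ≥ 4 and let A_{jk} = (σ/2) W_{jk} e^{−i α_{jk}} + (i/2) ω_j δ_{jk}. Suppose (A) for every ℓ ∈ {1,…,N} the off-diagonal entries of column ℓ of A are all equal, i.e., A_{jℓ} = A_{kℓ} =: 𝒜_ℓ for all j, k ≠ ℓ, and (B) ω_j − 2 Im(𝒜_j) = ω_k − 2 Im(𝒜_k) for all j ≠ k. Then: (i) for every quadruple of pairwise distinct indices a,b,c,d, the phase cross-ratio C_{abcd} satisfies Σ_j F_j(θ) ∂C_{abcd}/∂θ_j(θ) = 0 at every θ where it is defined; and (ii) the map θ ↦ (C_{1234}(θ), C_{2345}(θ), …, C_{(N−3)(N−2)(N−1)N}(θ)) has Jacobian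 matrix of rank N − 3 at every θ for which the points e^{iθ_1}, …, e^{iθ_N} are pairwise distinct; hence the Kuramoto model admits N − 3 functionally independent conserved cross-ratios. -/
/-- The complex interaction matrix `A_{jk} = (σ/2) W_{jk} e^{-i α_{jk}} + (i/2) ω_j δ_{jk}`. -/
noncomputable def kuramotoA {N : ℕ} (W α : Fin N → Fin N → ℝ) (ω : Fin N → ℝ) (σ : ℝ)
    (j k : Fin N) : ℂ :=
  ((σ : ℂ) / 2) * (W j k : ℂ) * Complex.exp (-Complex.I * (α j k : ℂ))
    + (Complex.I / 2) * (ω j : ℂ) * (if j = k then 1 else 0)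

/-- The derivative of the half-angle chord `sin ((θ x - θ y) / 2)`. -/
theorem hasFDerivAt_sin_half_sub {N : ℕ} (x y : Fin N) (θ : Fin N → ℝ) :
    HasFDerivAt (fun θ : Fin N → ℝ => Real.sin ((θ x - θ y) / 2))
      (Real.cos ((θ x - θ y) / 2) • ((2⁻¹ : ℝ) •
        ((ContinuousLinearMap.proj x : (Fin N → ℝ) →L[ℝ] ℝ) -
          (ContinuousLinearMap.proj y : (Fin N → ℝ) →L[ℝ] ℝ)))) θ := by
  have h := (((ContinuousLinearMap.proj x : (Fin N → ℝ) →L[ℝ] ℝ) -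
    (ContinuousLinearMap.proj y : (Fin N → ℝ) →L[ℝ] ℝ)).hasFDerivAt (x := θ)).const_mul (2⁻¹ : ℝ)
  have hhalf : HasFDerivAt (fun θ : Fin N → ℝ => (θ x - θ y) / 2) ((2⁻¹ : ℝ) •
      ((ContinuousLinearMap.proj x : (Fin N → ℝ) →L[ℝ] ℝ) -
        (ContinuousLinearMap.proj y : (Fin N → ℝ) →L[ℝ] ℝ))) θ := by
    refine h.congr_of_eventuallyEq (Filter.Eventually.of_forall fun η => ?_)
    simp only [sub_apply, ContinuousLinearMap.proj_apply]
    ring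
  exact hhalf.sin

/-- The directional derivative of the cross-ratio, by the quotient rule. -/
theorem fderiv_crossRatioTheta_apply {N : ℕ} (a b c d : Fin N) (θ v : Fin N → ℝ)
    (h : Real.sin ((θ c - θ b) / 2) * Real.sin ((θ d - θ a) / 2) ≠ 0) :
    fderiv ℝ (crossRatioTheta a b c d) θ v =
      ((Real.cos ((θ c - θ a) / 2) * ((v c - v a) / 2) * Real.sin ((θ d - θ b) / 2) +
          Real.sin ((θ c - θ a) / 2) * (Real.cos ((θ d - θ b) / 2) * ((v d - v b) / 2))) *
          (Real.sin ((θ c - θ b) / 2) * Real.sin ((θ d - θ a) / 2)) -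
        Real.sin ((θ c - θ a) / 2) * Real.sin ((θ d - θ b) / 2) *
          (Real.cos ((θ c - θ b) / 2) * ((v c - v b) / 2) * Real.sin ((θ d - θ a) / 2) +
          Real.sin ((θ c - θ b) / 2) * (Real.cos ((θ d - θ a) / 2) * ((v d - v a) / 2)))) /
        (Real.sin ((θ c - θ b) / 2) * Real.sin ((θ d - θ a) / 2)) ^ 2 := by
  have hD : HasFDerivAt (crossRatioTheta a b c d) _ θ :=
    ((hasFDerivAt_sin_half_sub c a θ).fun_mul (hasFDerivAt_sin_half_sub d b θ)).fun_mul
      ((hasDerivAt_inv h).comp_hasFDerivAt θ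
        ((hasFDerivAt_sin_half_sub c b θ).fun_mul (hasFDerivAt_sin_half_sub d a θ)))
  rw [hD.fderiv]
  simp only [smul_apply, sub_apply, add_apply,
    ContinuousLinearMap.proj_apply, smul_eq_mul]
  field_simp
  ring

/-- Cross-ratios are invariant under the infinitesimal Möbius action on the circle. -/
theorem fderiv_crossRatioTheta_apply_eq_zero {N : ℕ} (a b c d : Fin N) (θ v : Fin N → ℝ)
    (h : Real.sin ((θ c - θ b) / 2) * Real.sin ((θ d - θ a) / 2) ≠ 0) (Ω P Q : ℝ)
    (hv : ∀ j, v j = Ω + P * Real.cos (θ j) + Q * Real.sin (θ j)) :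
    fderiv ℝ (crossRatioTheta a b c d) θ v = 0 := by
  set g : Fin N → ℝ := fun x => (-P * Real.sin (θ x) + Q * Real.cos (θ x)) / 2 with hg
  have key (x y : Fin N) : Real.cos ((θ x - θ y) / 2) * ((v x - v y) / 2) =
      Real.sin ((θ x - θ y) / 2) * (g x + g y) := by
    have e : v x - v y = P * (Real.cos (θ x) - Real.cos (θ y)) +
        Q * (Real.sin (θ x) - Real.sin (θ y)) := by rw [hv, hv]; ring
    have e' : g x + g y = (-P * (Real.sin (θ x) + Real.sin (θ y)) +
        Q * (Real.cos (θ x) + Real.cos (θ y))) / 2 := by simp only [hg]; ring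
    rw [e, e', Real.cos_sub_cos, Real.sin_sub_sin, Real.sin_add_sin, Real.cos_add_cos]
    ring
  rw [fderiv_crossRatioTheta_apply a b c d θ v h]
  simp only [key]
  rw [div_eq_zero_iff]
  left
  ring

/-- The derivative of the cross-ratio in its last argument. -/
theorem fderiv_crossRatioTheta_single_last_ne_zero {N : ℕ} {a b c d : Fin N} (θ : Fin N → ℝ)
    (hθ : ∀ x y : Fin N, x ≠ y → Real.sin ((θ x - θ y) / 2) ≠ 0)
    (hab : a ≠ b) (hac : a ≠ c) (had : a ≠ d) (hbc : b ≠ c) (hbd : b ≠ d) (hcd : c ≠ d) :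
    fderiv ℝ (crossRatioTheta a b c d) θ (Pi.single d 1) ≠ 0 := by
  have h := mul_ne_zero (hθ c b hbc.symm) (hθ d a had.symm)
  rw [fderiv_crossRatioTheta_apply a b c d θ _ h]
  refine div_ne_zero ?_ (pow_ne_zero 2 h)
  have e : Real.sin ((θ b - θ a) / 2) =
      Real.sin ((θ d - θ a) / 2) * Real.cos ((θ d - θ b) / 2) -
        Real.cos ((θ d - θ a) / 2) * Real.sin ((θ d - θ b) / 2) := by
    rw [← Real.sin_sub]
    ring_nf
  have hne := mul_ne_zero (mul_ne_zero (hθ c a hac.symm) (hθ c b hbc.symm)) (hθ b a hab.symm)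
  contrapose hne
  simp only [Pi.single_eq_same, Pi.single_eq_of_ne had, Pi.single_eq_of_ne hbd,
    Pi.single_eq_of_ne hcd] at hne
  rw [e]
  linear_combination 2 * hne

/-- The cross-ratio does not depend on the phases of other oscillators. -/
theorem fderiv_crossRatioTheta_single_eq_zero {N : ℕ} {a b c d j : Fin N} (θ : Fin N → ℝ)
    (h : Real.sin ((θ c - θ b) / 2) * Real.sin ((θ d - θ a) / 2) ≠ 0)
    (ha : a ≠ j) (hb : b ≠ j) (hc : c ≠ j) (hd : d ≠ j) :
    fderiv ℝ (crossRatioTheta a b c d) θ (Pi.single j 1) = 0 := by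
  rw [fderiv_crossRatioTheta_apply a b c d θ _ h]
  simp [Pi.single_eq_of_ne ha, Pi.single_eq_of_ne hb, Pi.single_eq_of_ne hc, Pi.single_eq_of_ne hd]

theorem sin_half_sub_ne_zero_of_exp_ne {x y : ℝ}
    (h : Complex.exp (Complex.I * (x : ℂ)) ≠ Complex.exp (Complex.I * (y : ℂ))) :
    Real.sin ((x - y) / 2) ≠ 0 := by
  contrapose h
  obtain ⟨n, hn⟩ := Real.sin_eq_zero_iff.mp h
  rw [Complex.exp_eq_exp_iff_exists_int]
  refine ⟨n, ?_⟩
  have hx : x = y + n * (2 * Real.pi) := by linarith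
  rw [hx]
  push_cast
  ring

/-- A matrix with a square lower triangular submatrix of nonzero diagonal has full row rank. -/
theorem Matrix.rank_eq_card_of_lowerTriangular_submatrix {m : ℕ} {n K : Type*} [Fintype n]
    [Field K] (M : Matrix (Fin m) n K) (f : Fin m → n) (hdiag : ∀ i, M i (f i) ≠ 0)
    (hupper : ∀ i j, i < j → M i (f j) = 0) : M.rank = m := by
  have hdet : (M.submatrix id f).det ≠ 0 := by
    rw [Matrix.det_of_isLowerTriangular (M.submatrix id f) fun i j hij => hupper i j hij]
    exact Finset.prod_ne_zero_iff.mpr fun i _ => hdiag i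
  have hli : LinearIndependent K (M.submatrix id f).row :=
    Matrix.linearIndependent_rows_of_det_ne_zero hdet
  have hM : LinearIndependent K M.row := LinearIndependent.of_comp (LinearMap.funLeft K K f) hli
  simpa using hM.rank_matrix

theorem kuramotoA_re {N : ℕ} (W α : Fin N → Fin N → ℝ) (ω : Fin N → ℝ) (σ : ℝ) {j k : Fin N}
    (h : j ≠ k) : (kuramotoA W α ω σ j k).re = σ / 2 * W j k * Real.cos (α j k) := by
  have e : kuramotoA W α ω σ j k =
      ((σ / 2 * W j k : ℝ) : ℂ) * Complex.exp (((-α j k : ℝ) : ℂ) * Complex.I) := by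
    simp only [kuramotoA, if_neg h]
    push_cast
    ring_nf
  rw [e, Complex.re_ofReal_mul, Complex.exp_ofReal_mul_I_re, Real.cos_neg]

theorem kuramotoA_im {N : ℕ} (W α : Fin N → Fin N → ℝ) (ω : Fin N → ℝ) (σ : ℝ) {j k : Fin N}
    (h : j ≠ k) : (kuramotoA W α ω σ j k).im = -(σ / 2 * W j k * Real.sin (α j k)) := by
  have e : kuramotoA W α ω σ j k =
      ((σ / 2 * W j k : ℝ) : ℂ) * Complex.exp (((-α j k : ℝ) : ℂ) * Complex.I) := by
    simp only [kuramotoA, if_neg h]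
    push_cast
    ring_nf
  rw [e, Complex.im_ofReal_mul, Complex.exp_ofReal_mul_I_im, Real.sin_neg, mul_neg]

/-- If off-diagonal column entries of `A` are constant, each oscillator is driven by
a common first harmonic. -/
theorem kuramotoF_eq_of_column_const {N : ℕ} {W α : Fin N → Fin N → ℝ} {ω : Fin N → ℝ} {σ : ℝ}
    (hW : ∀ j, W j j = 0) (A : Fin N → ℂ) (hA : ∀ j k, j ≠ k → kuramotoA W α ω σ j k = A k)
    (θ : Fin N → ℝ) (j : Fin N) :
    kuramotoF W α ω σ θ j = (ω j - 2 * (A j).im) +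
      (∑ k, 2 * ((A k).re * Real.sin (θ k) + (A k).im * Real.cos (θ k))) * Real.cos (θ j) +
      (∑ k, 2 * ((A k).im * Real.sin (θ k) - (A k).re * Real.cos (θ k))) * Real.sin (θ j) := by
  have hterm (k : Fin N) : σ * (W j k * Real.sin (θ k - θ j - α j k)) =
      2 * ((A k).re * Real.sin (θ k) + (A k).im * Real.cos (θ k)) * Real.cos (θ j) +
      2 * ((A k).im * Real.sin (θ k) - (A k).re * Real.cos (θ k)) * Real.sin (θ j) -
      if j = k then 2 * (A k).im else 0 := by
    by_cases h : j = k
    · subst h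
      rw [hW, if_pos rfl]
      linear_combination (-2 * (A j).im) * Real.sin_sq_add_cos_sq (θ j)
    · rw [if_neg h, ← hA j k h, kuramotoA_re W α ω σ h, kuramotoA_im W α ω σ h,
        Real.sin_sub, Real.sin_sub, Real.cos_sub]
      ring
  rw [kuramotoF, Finset.mul_sum, Finset.sum_congr rfl fun k _ => hterm k,
    Finset.sum_sub_distrib, Finset.sum_add_distrib, Finset.sum_ite_eq, Finset.sum_mul,
    Finset.sum_mul]
  simp only [Finset.mem_univ, if_true]
  ring

/-- If all off-diagonal entries of each column of `A` coincide and the shifted natural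
frequencies agree, then every cross-ratio is conserved, and the consecutive cross-ratios
`C_{1234}, …, C_{(N−3)(N−2)(N−1)N}` have a Jacobian of full rank `N − 3` wherever the points
`e^{iθ_j}` are pairwise distinct: the Kuramoto model admits `N − 3` functionally independent
conserved cross-ratios. -/
theorem max_conserved_crossratios (N : ℕ) (hN : 4 ≤ N)
    (W α : Fin N → Fin N → ℝ) (ω : Fin N → ℝ) (σ : ℝ)
    (hW : ∀ j, W j j = 0) (hα : ∀ j, α j j = 0)
    (hαbound : ∀ j k, |α j k| ≤ Real.pi / 2)
    (hA : ∀ ℓ j k : Fin N, j ≠ ℓ → k ≠ ℓ →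
      kuramotoA W α ω σ j ℓ = kuramotoA W α ω σ k ℓ)
    (hB : ∀ j k j' k' : Fin N, j ≠ k → j' ≠ j → k' ≠ k →
      ω j - 2 * (kuramotoA W α ω σ j' j).im = ω k - 2 * (kuramotoA W α ω σ k' k).im) :
    (∀ a b c d : Fin N, a ≠ b → a ≠ c → a ≠ d → b ≠ c → b ≠ d → c ≠ d →
      ∀ θ : Fin N → ℝ,
        Real.sin ((θ c - θ b) / 2) * Real.sin ((θ d - θ a) / 2) ≠ 0 →
        ∑ j, kuramotoF W α ω σ θ j *
          fderiv ℝ (crossRatioTheta a b c d) θ (Pi.single j 1) = 0) ∧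
    (∀ θ : Fin N → ℝ,
      Function.Injective (fun j => Complex.exp (Complex.I * (θ j : ℂ))) →
      Matrix.rank (Matrix.of fun (i : Fin (N - 3)) (j : Fin N) =>
        fderiv ℝ (crossRatioTheta
          (⟨i.1, by have := i.isLt; omega⟩ : Fin N)
          (⟨i.1 + 1, by have := i.isLt; omega⟩ : Fin N)
          (⟨i.1 + 2, by have := i.isLt; omega⟩ : Fin N)
          (⟨i.1 + 3, by have := i.isLt; omega⟩ : Fin N)) θ (Pi.single j 1)) = N - 3) := by
  have : Nontrivial (Fin N) := Fin.nontrivial_iff_two_le.mpr (by omega)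
  refine ⟨fun a b c d _ _ _ _ _ _ θ h => ?_, fun θ hθ => ?_⟩
  · choose p hp using fun l : Fin N => exists_ne l
    set A : Fin N → ℂ := fun l => kuramotoA W α ω σ (p l) l with hAdef
    have hF := kuramotoF_eq_of_column_const hW A
      (fun j k hjk => hA k j (p k) hjk (hp k)) θ
    have hΩ (j : Fin N) : ω j - 2 * (A j).im = ω a - 2 * (A a).im := by
      rcases eq_or_ne j a with rfl | hj
      · rfl
      · exact hB j a (p j) (p a) hj (hp j) (hp a)
    have h0 := fderiv_crossRatioTheta_apply_eq_zero a b c d θ (kuramotoF W α ω σ θ) h _ _ _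
      (fun j => by rw [hF j, hΩ j])
    rw [← h0, ← Finset.univ_sum_single (kuramotoF W α ω σ θ), map_sum]
    refine Finset.sum_congr rfl fun j _ => ?_
    rw [← smul_eq_mul, ← map_smul, ← Pi.single_smul, smul_eq_mul, mul_one]
    simp
  · have hs (x y : Fin N) (hxy : x ≠ y) : Real.sin ((θ x - θ y) / 2) ≠ 0 :=
      sin_half_sub_ne_zero_of_exp_ne (hθ.ne hxy)
    refine Matrix.rank_eq_card_of_lowerTriangular_submatrix _
      (fun i => ⟨i.1 + 3, by have := i.isLt; omega⟩) (fun i => ?_) (fun i j hij => ?_)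
    · apply fderiv_crossRatioTheta_single_last_ne_zero θ hs <;> simp [Fin.ext_iff]
    · have hlt : i.1 < j.1 := hij
      refine fderiv_crossRatioTheta_single_eq_zero θ
        (mul_ne_zero (hs _ _ ?_) (hs _ _ ?_)) ?_ ?_ ?_ ?_ <;>
      simp only [ne_eq, Fin.mk.injEq] <;> omega
end
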